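/- The socle Soc(M) = (0 :_M (x,y,z)) of M satisfies Soc(M)_t = 0 for all t > d − a_1 − 3 and Soc(M)_{d − a_1 − 3} ≠ 0; that is, M has maximal socle degree d − a_1 − 3, where d = Σ_{j=1}^{n+2} b_j − Σ_{i=1}^n a_i. -/

import Mathlib

open MvPolynomial

noncomputable section

/-- The height (codimension) of an ideal: the infimum of the heights of the
prime ideals containing it. -/
def idealHeight {R : Type*} [CommRing R] (I : Ideal R) : ℕ∞ :=
  ⨅ (p : PrimeSpectrum R) (_ : I ≤ p.asIdeal), Order.height p

/-- The degree-`z` homogeneous component of `K[x₁, …, x_r]`, for `z : ℤ`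
(it is zero in negative degrees). -/
def hcomp (K : Type*) [Field K] (r : ℕ) (z : ℤ) : Submodule K (MvPolynomial (Fin r) K) :=
  if 0 ≤ z then homogeneousSubmodule (Fin r) K z.toNat else ⊥

/-- The degree-`t` graded piece of the cokernel `M` of the graded map
`φ : ⊕_j R(-b j) → ⊕_i R(-a i)`: the image of the degree-`t` piece
`⊕_i R(-a i)_t = ⊕_i R_{t - a i}` of the free module. -/
def cokerPiece {K : Type*} [Field K] {n m : ℕ}
    (φ : Matrix (Fin n) (Fin m) (MvPolynomial (Fin 3) K)) (a : Fin n → ℤ) (t : ℤ) :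
    Submodule K ((Fin n → MvPolynomial (Fin 3) K) ⧸ LinearMap.range φ.mulVecLin) :=
  (Submodule.pi Set.univ fun i => hcomp K 3 (t - a i)).map
    ((LinearMap.range φ.mulVecLin).mkQ.restrictScalars K)

end

/-! ### Length three complexes over a regular sequence -/

section RegularTriple

variable {R : Type*} [CommRing R]

/-- Three ring elements forming a weakly regular sequence on the module `E`, spelled out in terms
of elements. -/
structure IsRegularTriple (f : Fin 3 → R) (E : Type*) [AddCommGroup E] [Module R E] : Prop where
  inj : ∀ c d : E, f 0 • c = f 0 • d → c = d
  fst : ∀ c d : E, f 1 • c = f 0 • d → ∃ e, c = f 0 • e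
  snd : ∀ c d e : E, f 2 • c = f 0 • d + f 1 • e → ∃ s t, c = f 0 • s + f 1 • t

theorem IsRegularTriple.pi {f : Fin 3 → R} (h : IsRegularTriple f R) (ι : Type*) :
    IsRegularTriple f (ι → R) where
  inj c d hcd := funext fun i => h.inj _ _ (congrFun hcd i)
  fst c d hcd := by
    choose e he using fun i => h.fst _ _ (congrFun hcd i)
    exact ⟨e, funext he⟩
  snd c d e hcd := by
    choose s t hst using fun i => h.snd _ _ _ (congrFun hcd i)
    exact ⟨s, t, funext hst⟩

variable {E : Type*} [AddCommGroup E] [Module R E] {f : Fin 3 → R}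

theorem IsRegularTriple.exists_smul_eq (h : IsRegularTriple f E) {v : Fin 3 → E}
    (h₁ : f 0 • v 1 = f 1 • v 0) (h₂ : f 0 • v 2 = f 2 • v 0) :
    ∃ q, ∀ k, v k = f k • q := by
  obtain ⟨q, hq⟩ := h.fst _ _ h₁.symm
  refine ⟨q, fun k => ?_⟩
  fin_cases k
  · exact hq
  · exact h.inj _ _ (show f 0 • v 1 = f 0 • f 1 • q by rw [h₁, hq, smul_comm])
  · exact h.inj _ _ (show f 0 • v 2 = f 0 • f 2 • q by rw [h₂, hq, smul_comm])

theorem IsRegularTriple.exists_koszul_eq (h : IsRegularTriple f E) {w : Fin 3 → E}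
    (hw : f 0 • w 0 - f 1 • w 1 + f 2 • w 2 = 0) :
    ∃ p : Fin 3 → E, w 0 = f 1 • p 2 - f 2 • p 1 ∧ w 1 = f 0 • p 2 - f 2 • p 0 ∧
      w 2 = f 0 • p 1 - f 1 • p 0 := by
  obtain ⟨p₁, p₀, hp⟩ := h.snd (w 2) (-w 0) (w 1) (by
    rw [← sub_eq_zero, ← hw]; module)
  obtain ⟨p₂, hp₂⟩ := h.fst (w 1 - f 2 • p₀) (w 0 + f 2 • p₁) (by
    rw [hp] at hw
    rw [← sub_eq_zero, ← neg_eq_zero, ← hw]; module)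
  refine ⟨![-p₀, p₁, p₂], ?_, ?_, ?_⟩
  · refine h.inj _ _ ?_
    rw [hp] at hw
    have : f 0 • w 0 = f 1 • w 1 - f 2 • (f 0 • p₁ + f 1 • p₀) := by
      rw [← sub_eq_zero, ← hw]; module
    rw [this, sub_eq_iff_eq_add.1 hp₂]
    simp; module
  · rw [sub_eq_iff_eq_add.1 hp₂]
    simp
  · rw [hp]; simp

variable {F₀ F₁ F₂ F₃ : Type*} [AddCommGroup F₀] [AddCommGroup F₁] [AddCommGroup F₂]
  [AddCommGroup F₃] [Module R F₀] [Module R F₁] [Module R F₂] [Module R F₃]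
  {d₁ : F₁ →ₗ[R] F₀} {d₂ : F₂ →ₗ[R] F₁} {d₃ : F₃ →ₗ[R] F₂}

theorem exact_left_of_regularTriple (h₂ : IsRegularTriple f F₂) (h₃ : IsRegularTriple f F₃)
    (inj : Function.Injective d₃)
    (ann : ∀ k, ∀ w, d₂ w = 0 → ∃ c, d₃ c = f k • w) {w : F₂} (hw : d₂ w = 0) :
    ∃ c, d₃ c = w := by
  obtain ⟨c₀, hc₀⟩ := ann 0 w hw
  obtain ⟨c₁, hc₁⟩ := ann 1 w hw
  obtain ⟨e, rfl⟩ := h₃.fst c₀ c₁ (inj (by rw [map_smul, map_smul, hc₀, hc₁, smul_comm]))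
  exact ⟨e, h₂.inj _ _ (by rw [← map_smul, hc₀])⟩

/-- An acyclicity criterion: a length three complex whose homology is killed by a regular sequence
of length three is exact. -/
theorem exact_right_of_regularTriple (h₁ : IsRegularTriple f F₁) (h₂ : IsRegularTriple f F₂)
    (h₃ : IsRegularTriple f F₃) (inj : Function.Injective d₃)
    (hd : ∀ c, d₂ (d₃ c) = 0)
    (ann₃ : ∀ k, ∀ w, d₂ w = 0 → ∃ c, d₃ c = f k • w)
    (ann₂ : ∀ k, ∀ v, d₁ v = 0 → ∃ w, d₂ w = f k • v) {v : F₁} (hv : d₁ v = 0) :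
    ∃ w, d₂ w = v := by
  have ex {w : F₂} (hw : d₂ w = 0) := exact_left_of_regularTriple h₂ h₃ inj ann₃ hw
  choose u hu using fun k => ann₂ k v hv
  have key (k l) : d₂ (f k • u l - f l • u k) = 0 := by
    rw [map_sub, map_smul, map_smul, hu, hu, smul_comm, sub_self]
  obtain ⟨c₀, hc₀⟩ := ex (key 1 2)
  obtain ⟨c₁, hc₁⟩ := ex (key 0 2)
  obtain ⟨c₂, hc₂⟩ := ex (key 0 1)
  obtain ⟨p, -, -, hp⟩ := h₃.exists_koszul_eq (w := ![c₀, c₁, c₂]) (inj (by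
    simp only [Matrix.cons_val, map_add, map_sub, map_smul, hc₀, hc₁, hc₂, map_zero]
    module))
  obtain ⟨e, he⟩ := h₂.fst (u 0 - d₃ (p 0)) (u 1 - d₃ (p 1)) (by
    simp only [Matrix.cons_val] at hp
    rw [hp, map_sub, map_smul, map_smul] at hc₂
    rw [smul_sub, smul_sub, sub_eq_sub_iff_add_eq_add, ← sub_eq_zero]
    rw [← sub_eq_zero] at hc₂
    rw [← hc₂]; module)
  refine ⟨e, h₁.inj _ _ ?_⟩
  rw [← map_smul, ← he, map_sub, hu, hd, sub_zero]

/-- A zigzag through the double complex obtained by tensoring a length three complex with the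
Koszul complex, relating an element `u` of the socle of the cokernel of `d₁` to an element `c` of
the last term. -/
structure IsZigzag (f : Fin 3 → R) (d₁ : F₁ →ₗ[R] F₀) (d₂ : F₂ →ₗ[R] F₁) (d₃ : F₃ →ₗ[R] F₂)
    (u : F₀) (v : Fin 3 → F₁) (w : Fin 3 → F₂) (c : F₃) : Prop where
  d₁_eq : ∀ k, d₁ (v k) = f k • u
  d₂_eq_zero : d₂ (w 0) = f 1 • v 2 - f 2 • v 1
  d₂_eq_one : d₂ (w 1) = f 0 • v 2 - f 2 • v 0
  d₂_eq_two : d₂ (w 2) = f 0 • v 1 - f 1 • v 0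
  d₃_eq : d₃ c = f 0 • w 0 - f 1 • w 1 + f 2 • w 2

theorem exists_isZigzag_of_socle (ex₁ : ∀ v, d₁ v = 0 → ∃ w, d₂ w = v)
    (ex₂ : ∀ w, d₂ w = 0 → ∃ c, d₃ c = w) {u : F₀} (hu : ∀ k, ∃ v, d₁ v = f k • u) :
    ∃ v w c, IsZigzag f d₁ d₂ d₃ u v w c := by
  choose v hv using hu
  have key (k l) : d₁ (f k • v l - f l • v k) = 0 := by
    rw [map_sub, map_smul, map_smul, hv, hv, smul_comm, sub_self]
  obtain ⟨w₀, hw₀⟩ := ex₁ _ (key 1 2)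
  obtain ⟨w₁, hw₁⟩ := ex₁ _ (key 0 2)
  obtain ⟨w₂, hw₂⟩ := ex₁ _ (key 0 1)
  obtain ⟨c, hc⟩ := ex₂ (f 0 • w₀ - f 1 • w₁ + f 2 • w₂) (by
    simp only [map_add, map_sub, map_smul, hw₀, hw₁, hw₂]
    module)
  exact ⟨v, ![w₀, w₁, w₂], c, hv, hw₀, hw₁, hw₂, hc⟩

theorem exists_isZigzag_of_d₃_eq (h₀ : IsRegularTriple f F₀) (h₁ : IsRegularTriple f F₁)
    (hd₁ : ∀ w, d₁ (d₂ w) = 0) (hd₂ : ∀ c, d₂ (d₃ c) = 0) {w : Fin 3 → F₂} {c : F₃}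
    (hc : d₃ c = f 0 • w 0 - f 1 • w 1 + f 2 • w 2) :
    ∃ u v, IsZigzag f d₁ d₂ d₃ u v w c := by
  obtain ⟨v, hv₀, hv₁, hv₂⟩ := h₁.exists_koszul_eq (w := fun k => d₂ (w k)) (by
    rw [← hd₂ c, hc, map_add, map_sub, map_smul, map_smul, map_smul])
  obtain ⟨u, hu⟩ := h₀.exists_smul_eq (v := fun k => d₁ (v k))
    (by rw [← sub_eq_zero, ← map_smul, ← map_smul, ← map_sub, ← hv₂, hd₁])
    (by rw [← sub_eq_zero, ← map_smul, ← map_smul, ← map_sub, ← hv₁, hd₁])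
  exact ⟨u, v, hu, hv₀, hv₁, hv₂, hc⟩

theorem IsZigzag.exists_d₁_eq (h₀ : IsRegularTriple f F₀) (h₁ : IsRegularTriple f F₁)
    (h₂ : IsRegularTriple f F₂) (hd₁ : ∀ w, d₁ (d₂ w) = 0) (hd₂ : ∀ c, d₂ (d₃ c) = 0)
    {u : F₀} {v : Fin 3 → F₁} {w : Fin 3 → F₂} {c : F₃} (h : IsZigzag f d₁ d₂ d₃ u v w c)
    (e : Fin 3 → F₃) (hc : c = f 0 • e 0 + f 1 • e 1 + f 2 • e 2) : ∃ q, d₁ q = u := by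
  obtain ⟨p, hp₀, hp₁, hp₂⟩ := h₂.exists_koszul_eq
    (w := ![w 0 - d₃ (e 0), w 1 + d₃ (e 1), w 2 - d₃ (e 2)]) (by
      have := h.d₃_eq
      rw [hc, map_add, map_add, map_smul, map_smul, map_smul, ← sub_eq_zero, ← neg_eq_zero] at this
      rw [← this]
      simp only [Matrix.cons_val]
      module)
  simp only [Matrix.cons_val] at hp₀ hp₁ hp₂
  obtain ⟨q, hq⟩ := h₁.exists_smul_eq (v := fun k => v k - d₂ (p k))
    (by
      have := congrArg d₂ hp₂
      rw [map_sub, hd₂, sub_zero, h.d₂_eq_two, map_sub, map_smul, map_smul, ← sub_eq_zero] at this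
      rw [← sub_eq_zero, ← this]; module)
    (by
      have := congrArg d₂ hp₁
      rw [map_add, hd₂, add_zero, h.d₂_eq_one, map_sub, map_smul, map_smul, ← sub_eq_zero] at this
      rw [← sub_eq_zero, ← this]; module)
  refine ⟨q, h₀.inj _ _ ?_⟩
  rw [← map_smul, ← hq 0, map_sub, hd₁, sub_zero, h.d₁_eq]

theorem IsZigzag.exists_eq_of_d₁_eq (ex₁ : ∀ v, d₁ v = 0 → ∃ w, d₂ w = v)
    (ex₂ : ∀ w, d₂ w = 0 → ∃ c, d₃ c = w) (inj : Function.Injective d₃)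
    {u : F₀} {v : Fin 3 → F₁} {w : Fin 3 → F₂} {c : F₃} (h : IsZigzag f d₁ d₂ d₃ u v w c)
    {q : F₁} (hq : d₁ q = u) : ∃ e : Fin 3 → F₃, c = f 0 • e 0 + f 1 • e 1 + f 2 • e 2 := by
  choose p hp using fun k => ex₁ (v k - f k • q) (by
    rw [map_sub, map_smul, hq, h.d₁_eq, sub_self])
  have key (k l) : d₂ (f k • p l - f l • p k) = f k • v l - f l • v k := by
    rw [map_sub, map_smul, map_smul, hp, hp]
    module
  obtain ⟨e₀, he₀⟩ := ex₂ (w 0 - (f 1 • p 2 - f 2 • p 1)) (by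
    rw [map_sub, key, h.d₂_eq_zero, sub_self])
  obtain ⟨e₁, he₁⟩ := ex₂ (w 1 - (f 0 • p 2 - f 2 • p 0)) (by
    rw [map_sub, key, h.d₂_eq_one, sub_self])
  obtain ⟨e₂, he₂⟩ := ex₂ (w 2 - (f 0 • p 1 - f 1 • p 0)) (by
    rw [map_sub, key, h.d₂_eq_two, sub_self])
  refine ⟨![e₀, -e₁, e₂], inj ?_⟩
  simp only [Matrix.cons_val, map_add, map_smul, map_neg, he₀, he₁, he₂, h.d₃_eq]
  module

end RegularTriple
/-! ### The Buchsbaum–Rim complex of an `n × (n + 2)` matrix -/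

section BuchsbaumRim

open Matrix

variable {R : Type*} [CommRing R] {n : ℕ} (φ : Matrix (Fin n) (Fin (n + 2)) R)

/-- The square matrix with first rows `p` and `q`, followed by the rows of `φ`. -/
def borderedMatrix (p q : Fin (n + 2) → R) : Matrix (Fin (n + 2)) (Fin (n + 2)) R :=
  Matrix.of (vecCons p (vecCons q φ))

/-- The alternating form sending `(p, q)` to the determinant of the square matrix with rows
`p`, `q` and the rows of `φ`. -/
noncomputable def borderedDet : (Fin (n + 2) → R) →ₗ[R] (Fin (n + 2) → R) →ₗ[R] R :=
  LinearMap.mk₂ R (fun p q => (detRowAlternating.curryLeft p).curryLeft q φ)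
    (fun _ _ _ => by rw [map_add, AlternatingMap.curryLeft_add]; rfl)
    (fun _ _ _ => by rw [map_smul, AlternatingMap.curryLeft_smul]; rfl)
    (fun _ _ _ => by rw [map_add]; rfl) (fun _ _ _ => by rw [map_smul]; rfl)

theorem borderedDet_apply (p q : Fin (n + 2) → R) :
    borderedDet φ p q = (borderedMatrix φ p q).det := rfl

theorem borderedDet_isAlt : (borderedDet φ).IsAlt := fun p =>
  det_zero_of_row_eq (i := (0 : Fin (n + 2))) (j := 1) (by simp) rfl

theorem borderedDet_row_left (i : Fin n) (q : Fin (n + 2) → R) : borderedDet φ (φ i) q = 0 :=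
  det_zero_of_row_eq (i := (0 : Fin (n + 2))) (j := i.succ.succ) (Fin.succ_ne_zero _).symm rfl

theorem borderedDet_row_right (p : Fin (n + 2) → R) (i : Fin n) : borderedDet φ p (φ i) = 0 := by
  rw [← (borderedDet_isAlt φ).neg, borderedDet_row_left, neg_zero]

omit [CommRing R] in
theorem updateRow_zero_borderedMatrix (p q r : Fin (n + 2) → R) :
    (borderedMatrix φ p q).updateRow 0 r = borderedMatrix φ r q := by
  funext i
  refine Fin.cases ?_ (fun i => ?_) i
  · exact updateRow_self
  · exact updateRow_ne (Fin.succ_ne_zero i)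

omit [CommRing R] in
theorem updateRow_one_borderedMatrix (p q r : Fin (n + 2) → R) :
    (borderedMatrix φ p q).updateRow 1 r = borderedMatrix φ p r := by
  funext i
  refine Fin.cases ?_ (Fin.cases ?_ fun i => ?_) i
  · exact updateRow_ne (by simp)
  · exact updateRow_self
  · exact updateRow_ne fun h => Fin.succ_ne_zero i (Fin.succ_injective _ h)

/-- The middle map of the Buchsbaum–Rim complex, given by the skew-symmetric matrix of signed
maximal minors. -/
noncomputable def middleMap : (Fin (n + 2) → R) →ₗ[R] (Fin (n + 2) → R) :=
  LinearMap.pi fun j => borderedDet φ (Pi.single j 1)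

theorem middleMap_apply (w : Fin (n + 2) → R) (j : Fin (n + 2)) :
    middleMap φ w j = borderedDet φ (Pi.single j 1) w := rfl

theorem dotProduct_middleMap (v w : Fin (n + 2) → R) :
    v ⬝ᵥ middleMap φ w = borderedDet φ v w := by
  conv_rhs => rw [pi_eq_sum_univ' v]
  simp only [dotProduct, middleMap_apply, map_sum, map_smul, LinearMap.sum_apply,
    LinearMap.smul_apply, smul_eq_mul]

theorem mulVec_middleMap (w : Fin (n + 2) → R) : φ *ᵥ middleMap φ w = 0 := by
  funext i
  change φ i ⬝ᵥ middleMap φ w = 0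
  rw [dotProduct_middleMap, borderedDet_row_left]

theorem middleMap_transpose_mulVec (c : Fin n → R) : middleMap φ (φᵀ *ᵥ c) = 0 := by
  funext j
  rw [mulVec_transpose, vecMul_eq_sum, middleMap_apply, map_sum]
  refine Finset.sum_eq_zero fun i _ => ?_
  rw [map_smul, borderedDet_row_right, smul_zero]

theorem borderedMatrix_mulVec {p q v : Fin (n + 2) → R} (hv : φ *ᵥ v = 0) :
    borderedMatrix φ p q *ᵥ v = Pi.single 0 (p ⬝ᵥ v) + Pi.single 1 (q ⬝ᵥ v) := by
  funext i
  refine Fin.cases ?_ (Fin.cases ?_ fun i => ?_) i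
  · rw [Pi.add_apply, Pi.single_eq_same, Pi.single_eq_of_ne (by simp), add_zero]; rfl
  · rw [Pi.add_apply, Pi.single_eq_of_ne (by simp)]
    refine Eq.trans ?_ (zero_add _).symm
    exact (Pi.single_eq_same (M := fun _ : Fin (n + 2) => R) 1 (q ⬝ᵥ v)).symm
  · have h₁ : i.succ.succ ≠ 1 := fun h => Fin.succ_ne_zero i (Fin.succ_injective _ h)
    rw [Pi.add_apply, Pi.single_eq_of_ne (Fin.succ_ne_zero _), Pi.single_eq_of_ne h₁, add_zero]
    exact congrFun hv i

theorem exists_middleMap_eq_smul {v : Fin (n + 2) → R} (hv : φ *ᵥ v = 0)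
    (p q : Fin (n + 2) → R) : ∃ w, middleMap φ w = borderedDet φ p q • v := by
  refine ⟨(p ⬝ᵥ v) • q - (q ⬝ᵥ v) • p, funext fun j => ?_⟩
  have h := congrFun (congrArg (adjugate (borderedMatrix φ p q) *ᵥ ·)
    (borderedMatrix_mulVec φ (p := p) (q := q) hv)) j
  simp only [mulVec_mulVec, adjugate_mul, smul_mulVec, one_mulVec, mulVec_add, mulVec_single,
    Pi.add_apply, Pi.smul_apply, col_apply, op_smul_eq_smul, adjugate_apply,
    updateRow_zero_borderedMatrix, updateRow_one_borderedMatrix, ← borderedDet_apply] at h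
  rw [Pi.smul_apply, h, middleMap_apply, map_sub, map_smul, map_smul,
    ← (borderedDet_isAlt φ).neg p, smul_neg, sub_neg_eq_add]

theorem exists_transpose_mulVec_eq_smul {w : Fin (n + 2) → R} (hw : middleMap φ w = 0)
    (p q : Fin (n + 2) → R) : ∃ c, φᵀ *ᵥ c = borderedDet φ p q • w := by
  have h (u) : borderedDet φ u w = 0 := by
    rw [← dotProduct_middleMap, hw, dotProduct_zero]
  have h₀ : cramer (borderedMatrix φ p q)ᵀ w 0 = 0 := by
    rw [cramer_transpose_apply, updateRow_zero_borderedMatrix, ← borderedDet_apply,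
      ← (borderedDet_isAlt φ).neg, h, neg_zero]
  have h₁ : cramer (borderedMatrix φ p q)ᵀ w 1 = 0 := by
    rw [cramer_transpose_apply, updateRow_one_borderedMatrix, ← borderedDet_apply, h]
  refine ⟨fun i => cramer (borderedMatrix φ p q)ᵀ w i.succ.succ, ?_⟩
  have := mulVec_cramer (borderedMatrix φ p q)ᵀ w
  rw [det_transpose, ← borderedDet_apply] at this
  rw [← this, mulVec_eq_sum, mulVec_eq_sum, Fin.sum_univ_succ, Fin.sum_univ_succ, h₀,
    Fin.succ_zero_eq_one, h₁]
  simp only [MulOpposite.op_zero, zero_smul, zero_add]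
  rfl

theorem det_eq_of_row_zero_eq_single {m : ℕ} (A : Matrix (Fin (m + 1)) (Fin (m + 1)) R)
    (hA : A 0 = Pi.single 0 1) : A.det = (A.submatrix Fin.succ Fin.succ).det := by
  rw [det_succ_row_zero, Finset.sum_eq_single 0, hA]
  · rw [Pi.single_eq_same, Fin.val_zero, pow_zero, one_mul, one_mul, Fin.succAbove_zero]
  · intro j _ hj
    rw [hA, Pi.single_eq_of_ne hj, mul_zero, zero_mul]
  · simp

theorem exists_borderedDet_eq_det_submatrix {g : Fin n → Fin (n + 2)} (hg : g.Injective) :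
    ∃ p q, borderedDet φ p q = (φ.submatrix id g).det := by
  have not_surj {m : ℕ} (hm : m < n + 2) (f : Fin m → Fin (n + 2)) : ∃ y, y ∉ Set.range f := by
    by_contra! h
    exact absurd (Fintype.card_le_of_surjective f h) (by simpa using hm)
  obtain ⟨k, hk⟩ := not_surj (by lia) g
  have hg₁ : (Fin.cons k g : Fin (n + 1) → Fin (n + 2)).Injective :=
    Fin.cons_injective_iff.2 ⟨hk, hg⟩
  obtain ⟨l, hl⟩ := not_surj (by lia) (Fin.cons k g : Fin (n + 1) → Fin (n + 2))
  have hg₂ : (Fin.cons l (Fin.cons k g : Fin (n + 1) → Fin (n + 2)) :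
      Fin (n + 2) → Fin (n + 2)).Injective := Fin.cons_injective_iff.2 ⟨hl, hg₁⟩
  let σ : Equiv.Perm (Fin (n + 2)) := Equiv.ofBijective _ (Finite.injective_iff_bijective.1 hg₂)
  have hσ₀ : σ 0 = l := rfl
  have hσ₁ : σ 1 = k := rfl
  let s : R := ((Equiv.Perm.sign σ : ℤ) : R)
  have hs : s * s = 1 := by
    rw [← Int.cast_mul, Int.units_coe_mul_self, Int.cast_one]
  refine ⟨s • Pi.single l 1, Pi.single k 1, ?_⟩
  have h := det_permute' σ (borderedMatrix φ (Pi.single l 1) (Pi.single k 1))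
  rw [det_eq_of_row_zero_eq_single _ (funext fun j => ?_),
    det_eq_of_row_zero_eq_single _ (funext fun j => ?_)] at h
  · rw [map_smul, LinearMap.smul_apply, borderedDet_apply, smul_eq_mul]
    exact h.symm
  · change (Pi.single k 1 : Fin (n + 2) → R) (σ j.succ) = _
    rw [← hσ₁]
    simp only [Pi.single_apply, σ.injective.eq_iff]
    congr 1
    exact propext (Fin.succ_inj (b := 0))
  · change (Pi.single l 1 : Fin (n + 2) → R) (σ j) = _
    rw [← hσ₀]
    simp only [Pi.single_apply, σ.injective.eq_iff]

/-- The ideal generated by the maximal minors of `φ`. -/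
noncomputable def maximalMinors : Ideal R :=
  Ideal.span {m | ∃ g : Fin n → Fin (n + 2), Function.Injective g ∧ m = (φ.submatrix id g).det}

variable {φ} in
theorem exists_middleMap_eq_smul_of_mem {m : R} (hm : m ∈ maximalMinors φ) {v : Fin (n + 2) → R}
    (hv : φ *ᵥ v = 0) : ∃ w, middleMap φ w = m • v := by
  induction hm using Submodule.span_induction with
  | mem m h =>
    obtain ⟨g, hg, rfl⟩ := h
    obtain ⟨p, q, hpq⟩ := exists_borderedDet_eq_det_submatrix φ hg
    rw [← hpq]
    exact exists_middleMap_eq_smul φ hv p q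
  | zero => exact ⟨0, by rw [map_zero, zero_smul]⟩
  | add x y _ _ hx hy =>
    obtain ⟨w, hw⟩ := hx
    obtain ⟨w', hw'⟩ := hy
    exact ⟨w + w', by rw [map_add, hw, hw', add_smul]⟩
  | smul r x _ hx =>
    obtain ⟨w, hw⟩ := hx
    exact ⟨r • w, by rw [map_smul, hw, smul_assoc]⟩

variable {φ} in
theorem exists_transpose_mulVec_eq_smul_of_mem {m : R} (hm : m ∈ maximalMinors φ)
    {w : Fin (n + 2) → R} (hw : middleMap φ w = 0) : ∃ c, φᵀ *ᵥ c = m • w := by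
  induction hm using Submodule.span_induction with
  | mem m h =>
    obtain ⟨g, hg, rfl⟩ := h
    obtain ⟨p, q, hpq⟩ := exists_borderedDet_eq_det_submatrix φ hg
    rw [← hpq]
    exact exists_transpose_mulVec_eq_smul φ hw p q
  | zero => exact ⟨0, by rw [mulVec_zero, zero_smul]⟩
  | add x y _ _ hx hy =>
    obtain ⟨c, hc⟩ := hx
    obtain ⟨c', hc'⟩ := hy
    exact ⟨c + c', by rw [mulVec_add, hc, hc', add_smul]⟩
  | smul r x _ hx =>
    obtain ⟨c, hc⟩ := hx
    exact ⟨r • c, by rw [mulVec_smul, hc, smul_assoc]⟩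

theorem transpose_mulVec_injective [IsDomain R] (h : maximalMinors φ ≠ ⊥) :
    Function.Injective φᵀ.mulVecLin := by
  have ⟨g, hg⟩ : ∃ g : Fin n → Fin (n + 2), (φ.submatrix id g).det ≠ 0 := by
    by_contra! hg
    refine h (Ideal.span_eq_bot.2 ?_)
    rintro _ ⟨g, -, rfl⟩
    exact hg g
  rw [← det_transpose] at hg
  refine (injective_iff_map_eq_zero _).2 fun c hc => eq_zero_of_mulVec_eq_zero hg ?_
  exact funext fun k => congrFun hc (g k)

end BuchsbaumRim
/-! ### Polynomial rings -/

section Polynomial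

variable {K : Type*} [Field K]

theorem mem_span_X_pow_of_X_pow_mul_mem {σ : Type*} {A : Set σ} {k : σ} (hk : k ∉ A) (N : ℕ)
    {c : MvPolynomial σ K}
    (hc : X k ^ N * c ∈ Ideal.span ((fun i => (X i : MvPolynomial σ K) ^ N) '' A)) :
    c ∈ Ideal.span ((fun i => (X i : MvPolynomial σ K) ^ N) '' A) := by
  have himg : (fun i => (X i : MvPolynomial σ K) ^ N) '' A =
      (fun s => monomial s (1 : K)) '' ((fun i => Finsupp.single i N) '' A) := by
    simp only [Set.image_image, X_pow_eq_monomial]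
  rw [himg, mem_ideal_span_monomial_image] at hc ⊢
  intro m hm
  obtain ⟨_, ⟨i, hi, rfl⟩, hle⟩ := hc (Finsupp.single k N + m) (by
    rwa [mem_support_iff, X_pow_eq_monomial, coeff_monomial_mul, one_mul, ← mem_support_iff])
  refine ⟨_, ⟨i, hi, rfl⟩, ?_⟩
  have hik : k ≠ i := by rintro rfl; exact hk hi
  simpa [Finsupp.single_le_iff, Finsupp.single_eq_of_ne' hik] using hle

theorem isRegularTriple_X_pow (N : ℕ) :
    IsRegularTriple (fun k => (X k : MvPolynomial (Fin 3) K) ^ N) (MvPolynomial (Fin 3) K) where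
  inj _ _ h := mul_left_cancel₀ (pow_ne_zero _ (X_ne_zero _)) h
  fst c d h := by
    have := mem_span_X_pow_of_X_pow_mul_mem (A := {(0 : Fin 3)}) (k := 1) (by simp) N (c := c) (by
      rw [Set.image_singleton, Ideal.mem_span_singleton]
      exact ⟨d, h⟩)
    rwa [Set.image_singleton, Ideal.mem_span_singleton] at this
  snd c d e h := by
    have := mem_span_X_pow_of_X_pow_mul_mem (A := {(0 : Fin 3), 1}) (k := 2) (by simp) N (c := c)
      (by
        rw [Set.image_pair, Ideal.mem_span_pair]
        exact ⟨d, e, by rw [mul_comm d, mul_comm e]; exact h.symm⟩)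
    rw [Set.image_pair, Ideal.mem_span_pair] at this
    obtain ⟨s, t, hst⟩ := this
    exact ⟨s, t, by rw [← hst, smul_eq_mul, smul_eq_mul, mul_comm s, mul_comm t]⟩

theorem isRegularTriple_X :
    IsRegularTriple (X : Fin 3 → MvPolynomial (Fin 3) K) (MvPolynomial (Fin 3) K) := by
  simpa only [pow_one] using isRegularTriple_X_pow (K := K) 1

theorem exists_eq_X_mul_of_constantCoeff_eq_zero {f : MvPolynomial (Fin 3) K}
    (hf : constantCoeff f = 0) :
    ∃ e : Fin 3 → MvPolynomial (Fin 3) K, f = X 0 * e 0 + X 1 * e 1 + X 2 * e 2 := by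
  have h : f ∈ Ideal.span (Set.range (X : Fin 3 → MvPolynomial (Fin 3) K)) := by
    rw [← Set.image_univ, mem_ideal_span_X_image]
    intro m hm
    by_contra! h
    have : m = 0 := Finsupp.ext fun i => h i (Set.mem_univ i)
    rw [this, mem_support_iff] at hm
    exact hm hf
  obtain ⟨e, he⟩ := Ideal.mem_span_range_iff_exists_fun.1 h
  refine ⟨e, ?_⟩
  rw [← he, Fin.sum_univ_three, mul_comm (e 0), mul_comm (e 1), mul_comm (e 2)]

theorem mem_hcomp_iff {r : ℕ} {z : ℤ} {f : MvPolynomial (Fin r) K} :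
    f ∈ hcomp K r z ↔ ∀ m, coeff m f ≠ 0 → (m.degree : ℤ) = z := by
  rw [hcomp]
  split_ifs with hz
  · rw [mem_homogeneousSubmodule]
    refine ⟨fun h m hm => ?_, fun h m hm => ?_⟩
    · have := h hm
      rw [Pi.one_def, ← Finsupp.degree_eq_weight_one] at this
      lia
    · have := h m hm
      rw [Pi.one_def, ← Finsupp.degree_eq_weight_one]
      lia
  · rw [Submodule.mem_bot]
    refine ⟨fun h m hm => absurd (by rw [h, coeff_zero]) hm, fun h => ?_⟩
    ext m
    by_contra hm
    have := h m hm
    lia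

theorem constantCoeff_eq_zero_of_mem_hcomp {r : ℕ} {z : ℤ} {f : MvPolynomial (Fin r) K}
    (hf : f ∈ hcomp K r z) (hz : z ≠ 0) : constantCoeff f = 0 := by
  by_contra h
  have := mem_hcomp_iff.1 hf 0 h
  rw [map_zero] at this
  exact hz this.symm

theorem mul_mem_hcomp {r : ℕ} {y z : ℤ} {f g : MvPolynomial (Fin r) K}
    (hf : f ∈ hcomp K r y) (hg : g ∈ hcomp K r z) : f * g ∈ hcomp K r (y + z) := by
  classical
  rw [mem_hcomp_iff] at *
  intro m hm
  rw [coeff_mul] at hm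
  obtain ⟨x, hx, hne⟩ := Finset.exists_ne_zero_of_sum_ne_zero hm
  have h₁ := hf _ (left_ne_zero_of_mul hne)
  have h₂ := hg _ (right_ne_zero_of_mul hne)
  rw [← Finset.HasAntidiagonal.mem_antidiagonal.1 hx, map_add]
  lia

theorem one_mem_hcomp {r : ℕ} : (1 : MvPolynomial (Fin r) K) ∈ hcomp K r 0 := by
  classical
  rw [mem_hcomp_iff]
  intro m hm
  rw [coeff_one, ne_eq, ite_eq_right_iff, Classical.not_imp] at hm
  rw [← hm.1, map_zero, Nat.cast_zero]

theorem X_mem_hcomp {r : ℕ} (k : Fin r) : (X k : MvPolynomial (Fin r) K) ∈ hcomp K r 1 := by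
  classical
  rw [mem_hcomp_iff]
  intro m hm
  rw [coeff_X, ne_eq, ite_eq_right_iff, Classical.not_imp] at hm
  rw [← hm.1, Finsupp.degree_single, Nat.cast_one]

theorem prod_mem_hcomp {r : ℕ} {ι : Type*} (s : Finset ι) {f : ι → MvPolynomial (Fin r) K}
    {z : ι → ℤ} (h : ∀ i ∈ s, f i ∈ hcomp K r (z i)) :
    ∏ i ∈ s, f i ∈ hcomp K r (∑ i ∈ s, z i) := by
  classical
  induction s using Finset.induction_on with
  | empty => simpa using one_mem_hcomp
  | insert i s hi ih =>
    rw [Finset.prod_insert hi, Finset.sum_insert hi]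
    exact mul_mem_hcomp (h i (Finset.mem_insert_self i s))
      (ih fun j hj => h j (Finset.mem_insert_of_mem hj))

theorem det_mem_hcomp {r : ℕ} {ι : Type*} [Fintype ι] [DecidableEq ι]
    {A : Matrix ι ι (MvPolynomial (Fin r) K)} {α β : ι → ℤ}
    (h : ∀ i j, A i j ∈ hcomp K r (β j - α i)) : A.det ∈ hcomp K r (∑ j, β j - ∑ i, α i) := by
  rw [Matrix.det_apply]
  refine Submodule.sum_mem _ fun σ _ => ?_
  have := prod_mem_hcomp Finset.univ fun i _ => h (σ i) i
  rw [Finset.sum_sub_distrib, Equiv.sum_comp σ α] at this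
  rcases Int.units_eq_one_or (Equiv.Perm.sign σ) with hs | hs <;> rw [hs]
  · rwa [one_smul]
  · rw [Units.neg_smul, one_smul]
    exact neg_mem this

/-- The projection onto the homogeneous component of degree `z`, for `z : ℤ`. -/
noncomputable def hproj (r : ℕ) (z : ℤ) : MvPolynomial (Fin r) K →ₗ[K] MvPolynomial (Fin r) K :=
  if 0 ≤ z then homogeneousComponent z.toNat else 0

theorem coeff_hproj {r : ℕ} (z : ℤ) (f : MvPolynomial (Fin r) K) (m : Fin r →₀ ℕ) :
    coeff m (hproj r z f) = if (m.degree : ℤ) = z then coeff m f else 0 := by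
  rw [hproj]
  split_ifs with hz hm hm
  · rw [coeff_homogeneousComponent, if_pos (by lia)]
  · rw [coeff_homogeneousComponent, if_neg (by lia)]
  · lia
  · rw [LinearMap.zero_apply, coeff_zero]

theorem hproj_mem {r : ℕ} (z : ℤ) (f : MvPolynomial (Fin r) K) :
    hproj r z f ∈ hcomp K r z := by
  rw [mem_hcomp_iff]
  intro m hm
  rw [coeff_hproj] at hm
  exact (ite_ne_right_iff.1 hm).1

theorem hproj_eq_self {r : ℕ} {z : ℤ} {f : MvPolynomial (Fin r) K} (hf : f ∈ hcomp K r z) :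
    hproj r z f = f := by
  ext m
  rw [coeff_hproj, ite_eq_left_iff]
  intro hm
  by_contra h
  exact hm (mem_hcomp_iff.1 hf m (Ne.symm h))

theorem hproj_mul {r : ℕ} {e : ℤ} {f : MvPolynomial (Fin r) K} (hf : f ∈ hcomp K r e) {y z : ℤ}
    (h : z = e + y) (g : MvPolynomial (Fin r) K) :
    hproj r z (f * g) = f * hproj r y g := by
  classical
  ext m
  rw [coeff_hproj, coeff_mul, coeff_mul]
  have key (x) (hx : x ∈ Finset.HasAntidiagonal.antidiagonal m) : coeff x.1 f * coeff x.2 (hproj r y g) =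
      if (m.degree : ℤ) = z then coeff x.1 f * coeff x.2 g else 0 := by
    rw [coeff_hproj]
    by_cases hf₀ : coeff x.1 f = 0
    · simp [hf₀]
    have := mem_hcomp_iff.1 hf _ hf₀
    rw [← Finset.HasAntidiagonal.mem_antidiagonal.1 hx, map_add]
    split_ifs <;> first | rfl | lia
  rw [Finset.sum_congr rfl key]
  split_ifs
  · rfl
  · rw [Finset.sum_const_zero]

/-- The projection of a graded free module, with generators in degrees `s i`, onto its component
of degree `z`. -/
noncomputable def gradedProj {r : ℕ} {ι : Type*} (s : ι → ℤ) (z : ℤ) :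
    (ι → MvPolynomial (Fin r) K) →ₗ[K] (ι → MvPolynomial (Fin r) K) :=
  LinearMap.pi fun i => hproj r (z - s i) ∘ₗ LinearMap.proj i

theorem gradedProj_apply {r : ℕ} {ι : Type*} (s : ι → ℤ) (z : ℤ)
    (u : ι → MvPolynomial (Fin r) K) (i : ι) : gradedProj s z u i = hproj r (z - s i) (u i) := rfl

theorem gradedProj_X_smul {r : ℕ} {ι : Type*} (s : ι → ℤ) {y z : ℤ} (h : z = y + 1) (k : Fin r)
    (u : ι → MvPolynomial (Fin r) K) :
    gradedProj s z ((X k : MvPolynomial (Fin r) K) • u) =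
      (X k : MvPolynomial (Fin r) K) • gradedProj s y u :=
  funext fun i => hproj_mul (X_mem_hcomp k) (by rw [h]; ring) (u i)

theorem gradedProj_map {r : ℕ} {ι κ : Type*} [Fintype κ] [DecidableEq κ] {α : ι → ℤ} {β : κ → ℤ}
    {d : (κ → MvPolynomial (Fin r) K) →ₗ[MvPolynomial (Fin r) K] (ι → MvPolynomial (Fin r) K)}
    (hd : ∀ i j, d (Pi.single j 1) i ∈ hcomp K r (β j - α i)) (z : ℤ)
    (v : κ → MvPolynomial (Fin r) K) :
    gradedProj α z (d v) = d (gradedProj β z v) := by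
  funext i
  have key (v) : d v i = ∑ j, d (Pi.single j 1) i * v j := by
    conv_lhs => rw [pi_eq_sum_univ' v]
    simp only [map_sum, map_smul, Finset.sum_apply, Pi.smul_apply, smul_eq_mul, mul_comm]
  rw [gradedProj_apply, key, key, map_sum]
  exact Finset.sum_congr rfl fun j _ => hproj_mul (hd i j) (by ring) (v j)

theorem IsZigzag.gradedProj {ι₀ ι₁ ι₂ ι₃ : Type*}
    {d₁ : (ι₁ → MvPolynomial (Fin 3) K) →ₗ[MvPolynomial (Fin 3) K] (ι₀ → MvPolynomial (Fin 3) K)}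
    {d₂ : (ι₂ → MvPolynomial (Fin 3) K) →ₗ[MvPolynomial (Fin 3) K] (ι₁ → MvPolynomial (Fin 3) K)}
    {d₃ : (ι₃ → MvPolynomial (Fin 3) K) →ₗ[MvPolynomial (Fin 3) K] (ι₂ → MvPolynomial (Fin 3) K)}
    {s₀ : ι₀ → ℤ} {s₁ : ι₁ → ℤ} {s₂ : ι₂ → ℤ} {s₃ : ι₃ → ℤ}
    (h₁ : ∀ z v, gradedProj s₀ z (d₁ v) = d₁ (gradedProj s₁ z v))
    (h₂ : ∀ z w, gradedProj s₁ z (d₂ w) = d₂ (gradedProj s₂ z w))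
    (h₃ : ∀ z c, gradedProj s₂ z (d₃ c) = d₃ (gradedProj s₃ z c)) {u v w c}
    (h : IsZigzag X d₁ d₂ d₃ u v w c) (t : ℤ) :
    IsZigzag X d₁ d₂ d₃ (_root_.gradedProj s₀ t u) (fun k => _root_.gradedProj s₁ (t + 1) (v k))
      (fun k => _root_.gradedProj s₂ (t + 2) (w k)) (_root_.gradedProj s₃ (t + 3) c) where
  d₁_eq k := by rw [← h₁, h.d₁_eq, gradedProj_X_smul _ rfl]
  d₂_eq_zero := by
    rw [← h₂, h.d₂_eq_zero, map_sub, gradedProj_X_smul _ (y := t + 1) (by ring),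
      gradedProj_X_smul _ (y := t + 1) (by ring)]
  d₂_eq_one := by
    rw [← h₂, h.d₂_eq_one, map_sub, gradedProj_X_smul _ (y := t + 1) (by ring),
      gradedProj_X_smul _ (y := t + 1) (by ring)]
  d₂_eq_two := by
    rw [← h₂, h.d₂_eq_two, map_sub, gradedProj_X_smul _ (y := t + 1) (by ring),
      gradedProj_X_smul _ (y := t + 1) (by ring)]
  d₃_eq := by
    rw [← h₃, h.d₃_eq, map_add, map_sub, gradedProj_X_smul _ (y := t + 2) (by ring),
      gradedProj_X_smul _ (y := t + 2) (by ring), gradedProj_X_smul _ (y := t + 2) (by ring)]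

theorem single_mem_hcomp {r : ℕ} {ι : Type*} [DecidableEq ι] (s : ι → ℤ) (j i : ι) :
    (Pi.single j 1 : ι → MvPolynomial (Fin r) K) i ∈ hcomp K r (s i - s j) := by
  obtain rfl | h := eq_or_ne i j
  · rw [Pi.single_eq_same, sub_self]
    exact one_mem_hcomp
  · rw [Pi.single_eq_of_ne h]
    exact zero_mem _

theorem borderedDet_single_mem_hcomp {r n : ℕ} {a : Fin n → ℤ} {b : Fin (n + 2) → ℤ}
    {φ : Matrix (Fin n) (Fin (n + 2)) (MvPolynomial (Fin r) K)}
    (hφ : ∀ i j, φ i j ∈ hcomp K r (b j - a i)) (j k : Fin (n + 2)) :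
    borderedDet φ (Pi.single j 1) (Pi.single k 1) ∈
      hcomp K r ((∑ l, b l - ∑ i, a i) - b k - b j) := by
  rw [borderedDet_apply]
  have h := det_mem_hcomp (A := borderedMatrix φ (Pi.single j 1) (Pi.single k 1))
    (α := Fin.cons (b j) (Fin.cons (b k) a)) (β := b) fun i l => by
      refine Fin.cases ?_ (Fin.cases ?_ fun i => ?_) i
      · exact single_mem_hcomp b j l
      · exact single_mem_hcomp b k l
      · exact hφ i l
  rw [Fin.sum_cons, Fin.sum_cons] at h
  convert h using 2
  ring

theorem aeval_C_mul_X_eq_zero {r : ℕ} {z : ℤ} {f : MvPolynomial (Fin r) K}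
    (hf : f ∈ hcomp K r z) {v : Fin r → K} (hv : aeval v f = 0) :
    aeval (fun k => Polynomial.C (v k) * Polynomial.X) f = 0 := by
  have key : aeval (fun k => Polynomial.C (v k) * Polynomial.X) f =
      Polynomial.C (aeval v f) * Polynomial.X ^ z.toNat := by
    rw [aeval_def, aeval_def, eval₂_eq', eval₂_eq', map_sum, Finset.sum_mul]
    refine Finset.sum_congr rfl fun m hm => ?_
    have hz := mem_hcomp_iff.1 hf m (mem_support_iff.1 hm)
    rw [Finsupp.degree_eq_sum] at hz
    simp only [mul_pow, Finset.prod_mul_distrib, Finset.prod_pow_eq_pow_sum, map_mul, map_prod,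
      map_pow, ← hz, Int.toNat_natCast, Polynomial.algebraMap_eq, Algebra.algebraMap_self_apply,
      mul_assoc]
  rw [key, hv, map_zero, zero_mul]

theorem eq_zero_of_mem_zeroLocus {I : Ideal (MvPolynomial (Fin 3) K)} (hht : 3 ≤ idealHeight I)
    {S : Set (MvPolynomial (Fin 3) K)} (hI : I = Ideal.span S)
    (hS : ∀ m ∈ S, ∃ z, m ∈ hcomp K 3 z) {v : Fin 3 → K} (hv : v ∈ zeroLocus K I) : v = 0 := by
  by_contra hv₀
  obtain ⟨k, hk⟩ := Function.ne_iff.1 hv₀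
  rw [mem_zeroLocus_iff] at hv
  let F : MvPolynomial (Fin 3) K →ₐ[K] Polynomial K :=
    aeval fun k => Polynomial.C (v k) * Polynomial.X
  have hF : (Polynomial.aeval (1 : K)).comp F = aeval v :=
    algHom_ext fun i => by
      rw [AlgHom.comp_apply, aeval_X, aeval_X, map_mul, Polynomial.aeval_C, Polynomial.aeval_X,
        mul_one, Algebra.algebraMap_self_apply]
  let p : PrimeSpectrum (MvPolynomial (Fin 3) K) := ⟨RingHom.ker F, RingHom.ker_isPrime F⟩
  let q : PrimeSpectrum (MvPolynomial (Fin 3) K) :=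
    ⟨RingHom.ker (aeval v : MvPolynomial (Fin 3) K →ₐ[K] K), RingHom.ker_isPrime _⟩
  have hIp : I ≤ p.asIdeal := by
    rw [hI, Ideal.span_le]
    intro m hm
    obtain ⟨z, hz⟩ := hS m hm
    exact aeval_C_mul_X_eq_zero hz (hv m (hI ▸ Ideal.subset_span hm))
  have hpq : p < q := by
    refine lt_of_le_not_ge (fun m (hm : F m = 0) => ?_) fun h => ?_
    · change aeval v m = 0
      rw [← hF, AlgHom.comp_apply, hm, map_zero]
    · have hmem : X k - C (v k) ∈ q.asIdeal := by
        change aeval v (X k - C (v k)) = 0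
        rw [map_sub, aeval_X, aeval_C, Algebra.algebraMap_self_apply, sub_self]
      have h₀ : F (X k - C (v k)) = 0 := h hmem
      rw [map_sub, aeval_X, aeval_C, Polynomial.algebraMap_eq] at h₀
      have := congrArg (Polynomial.coeff · 1) h₀
      simp only [Polynomial.coeff_sub, Polynomial.coeff_C_mul, Polynomial.coeff_X_one, mul_one,
        Polynomial.coeff_C_succ, sub_zero, Polynomial.coeff_zero] at this
      exact hk this
  have h₃ : 3 ≤ Order.height p := hht.trans (iInf₂_le p hIp)
  have h₄ : 3 + 1 ≤ Order.height q :=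
    (add_le_add_left h₃ 1).trans (Order.height_add_one_le hpq)
  have hdim : ringKrullDim (MvPolynomial (Fin 3) K) = 3 := by
    rw [ringKrullDim_of_isNoetherianRing, ringKrullDim_eq_zero_of_field, zero_add, Nat.card_fin]
    rfl
  have h₅ : ((3 + 1 : ℕ∞) : WithBot ℕ∞) ≤ 3 :=
    ((WithBot.coe_le_coe.2 h₄).trans (Order.height_le_krullDim q)).trans hdim.le
  exact absurd (WithBot.coe_le_coe.1 h₅) (by decide)

theorem exists_X_pow_mem [IsAlgClosed K] {I : Ideal (MvPolynomial (Fin 3) K)}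
    (hht : 3 ≤ idealHeight I) {S : Set (MvPolynomial (Fin 3) K)} (hI : I = Ideal.span S)
    (hS : ∀ m ∈ S, ∃ z, m ∈ hcomp K 3 z) : ∃ N, ∀ k, (X k : MvPolynomial (Fin 3) K) ^ N ∈ I := by
  have h (k : Fin 3) : (X k : MvPolynomial (Fin 3) K) ∈ I.radical := by
    rw [← vanishingIdeal_zeroLocus_eq_radical (K := K), mem_vanishingIdeal_iff]
    intro v hv
    rw [eq_zero_of_mem_zeroLocus hht hI hS hv, aeval_X, Pi.zero_apply]
  choose N hN using h
  refine ⟨∑ k, N k, fun k => I.pow_mem_of_pow_mem (hN k) ?_⟩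
  exact Finset.single_le_sum (fun _ _ => Nat.zero_le _) (Finset.mem_univ k)

theorem X_pow_mem_maximalMinors [IsAlgClosed K] {n : ℕ} {a : Fin n → ℤ} {b : Fin (n + 2) → ℤ}
    {φ : Matrix (Fin n) (Fin (n + 2)) (MvPolynomial (Fin 3) K)}
    (hφ : ∀ i j, φ i j ∈ hcomp K 3 (b j - a i)) (hht : 3 ≤ idealHeight (maximalMinors φ)) :
    ∃ N, ∀ k, (X k : MvPolynomial (Fin 3) K) ^ N ∈ maximalMinors φ := by
  refine exists_X_pow_mem hht rfl ?_
  rintro _ ⟨g, -, rfl⟩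
  exact ⟨_, det_mem_hcomp (β := b ∘ g) fun i j => hφ i (g j)⟩

theorem transpose_mulVec_injective_of_X_pow_mem {n N : ℕ}
    {φ : Matrix (Fin n) (Fin (n + 2)) (MvPolynomial (Fin 3) K)}
    (hN : ∀ k, (X k : MvPolynomial (Fin 3) K) ^ N ∈ maximalMinors φ) :
    Function.Injective φ.transpose.mulVecLin :=
  transpose_mulVec_injective φ fun h => pow_ne_zero N (X_ne_zero (0 : Fin 3)) <| by
    rw [← Ideal.mem_bot, ← h]
    exact hN 0

theorem exists_transpose_mulVec_eq {n N : ℕ}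
    {φ : Matrix (Fin n) (Fin (n + 2)) (MvPolynomial (Fin 3) K)}
    (hN : ∀ k, (X k : MvPolynomial (Fin 3) K) ^ N ∈ maximalMinors φ)
    {w : Fin (n + 2) → MvPolynomial (Fin 3) K} (hw : middleMap φ w = 0) :
    ∃ c, φ.transpose.mulVecLin c = w :=
  exact_left_of_regularTriple (d₂ := middleMap φ) ((isRegularTriple_X_pow N).pi _)
    ((isRegularTriple_X_pow N).pi _) (transpose_mulVec_injective_of_X_pow_mem hN)
    (fun k _ => exists_transpose_mulVec_eq_smul_of_mem (hN k)) hw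

theorem exists_middleMap_eq {n N : ℕ}
    {φ : Matrix (Fin n) (Fin (n + 2)) (MvPolynomial (Fin 3) K)}
    (hN : ∀ k, (X k : MvPolynomial (Fin 3) K) ^ N ∈ maximalMinors φ)
    {v : Fin (n + 2) → MvPolynomial (Fin 3) K} (hv : φ.mulVecLin v = 0) :
    ∃ w, middleMap φ w = v :=
  exact_right_of_regularTriple (d₁ := φ.mulVecLin) (d₂ := middleMap φ)
    (d₃ := φ.transpose.mulVecLin) ((isRegularTriple_X_pow N).pi _)
    ((isRegularTriple_X_pow N).pi _) ((isRegularTriple_X_pow N).pi _)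
    (transpose_mulVec_injective_of_X_pow_mem hN) (middleMap_transpose_mulVec φ)
    (fun k _ => exists_transpose_mulVec_eq_smul_of_mem (hN k))
    (fun k _ => exists_middleMap_eq_smul_of_mem (hN k)) hv

/-- Taking homogeneous components of a zigzag in the Buchsbaum–Rim complex of a graded matrix. -/
theorem IsZigzag.gradedProj_buchsbaumRim {n : ℕ} {a : Fin n → ℤ} {b : Fin (n + 2) → ℤ}
    {φ : Matrix (Fin n) (Fin (n + 2)) (MvPolynomial (Fin 3) K)}
    (hφ : ∀ i j, φ i j ∈ hcomp K 3 (b j - a i)) {d : ℤ} (hd : d = ∑ j, b j - ∑ i, a i) {u v w c}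
    (h : IsZigzag X φ.mulVecLin (middleMap φ) φ.transpose.mulVecLin u v w c) (t : ℤ) :
    ∃ v w, IsZigzag X φ.mulVecLin (middleMap φ) φ.transpose.mulVecLin (_root_.gradedProj a t u)
      v w (_root_.gradedProj (fun i => d - a i) (t + 3) c) := by
  refine ⟨_, _, h.gradedProj (s₁ := b) (s₂ := fun j => d - b j) (gradedProj_map fun i j => ?_)
    (gradedProj_map fun j k => ?_) (gradedProj_map fun j i => ?_) t⟩
  · rw [Matrix.mulVecLin_apply, Matrix.mulVec_single_one]
    exact hφ i j
  · rw [middleMap_apply, hd]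
    exact borderedDet_single_mem_hcomp hφ j k
  · rw [Matrix.mulVecLin_apply, Matrix.mulVec_single_one]
    have h := hφ i j
    rwa [show b j - a i = d - a i - (d - b j) by ring] at h

theorem gradedProj_eq_self {r : ℕ} {ι : Type*} {s : ι → ℤ} {z : ℤ}
    {u : ι → MvPolynomial (Fin r) K} (hu : ∀ i, u i ∈ hcomp K r (z - s i)) :
    gradedProj s z u = u :=
  funext fun i => hproj_eq_self (hu i)

theorem exists_eq_X_smul_of_constantCoeff_eq_zero {ι : Type*}
    {c : ι → MvPolynomial (Fin 3) K} (hc : ∀ i, constantCoeff (c i) = 0) :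
    ∃ e : Fin 3 → ι → MvPolynomial (Fin 3) K,
      c = (X 0 : MvPolynomial (Fin 3) K) • e 0 + (X 1 : MvPolynomial (Fin 3) K) • e 1 +
        (X 2 : MvPolynomial (Fin 3) K) • e 2 := by
  choose e he using fun i => exists_eq_X_mul_of_constantCoeff_eq_zero (hc i)
  exact ⟨fun k i => e i k, funext he⟩

end Polynomial

/-- The socle `Soc(M) = (0 :_M (x,y,z))` of `M = coker φ` satisfies
`Soc(M)_t = 0` for all `t > d - a 1 - 3` and `Soc(M)_{d - a 1 - 3} ≠ 0`; that is, `M`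
has maximal socle degree `d - a 1 - 3`, where `d = ∑ b j - ∑ a i`. -/
theorem stmt5 {K : Type*} [Field K] [IsAlgClosed K]
    (n : ℕ) (hn : 0 < n) (a : Fin n → ℤ) (b : Fin (n + 2) → ℤ)
    (ha : Monotone a) (hb : Monotone b)
    (φ : Matrix (Fin n) (Fin (n + 2)) (MvPolynomial (Fin 3) K))
    (hφ : ∀ i j, φ i j = 0 ∨
      (0 < b j - a i ∧ (φ i j).IsHomogeneous (b j - a i).toNat))
    (I : Ideal (MvPolynomial (Fin 3) K))
    (hI : I = Ideal.span {m | ∃ g : Fin n → Fin (n + 2),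
        Function.Injective g ∧ m = (φ.submatrix id g).det})
    (hht : idealHeight I = 3)
    (d : ℤ) (hd : d = (∑ j, b j) - ∑ i, a i) :
    -- the graded piece of the socle vanishes in all degrees `t > d - a₁ - 3` …
    (∀ t : ℤ, d - a ⟨0, hn⟩ - 3 < t →
      ∀ x ∈ cokerPiece φ a t, (∀ k : Fin 3, (X k : MvPolynomial (Fin 3) K) • x = 0) → x = 0) ∧
    -- … and is nonzero in degree `d - a₁ - 3`
    (∃ x ∈ cokerPiece φ a (d - a ⟨0, hn⟩ - 3),
      (∀ k : Fin 3, (X k : MvPolynomial (Fin 3) K) • x = 0) ∧ x ≠ 0) := by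
  subst hI
  change idealHeight (maximalMinors φ) = 3 at hht
  have hmem (i j) : φ i j ∈ hcomp K 3 (b j - a i) := by
    obtain h | ⟨hpos, h⟩ := hφ i j
    · rw [h]
      exact zero_mem _
    · rw [hcomp, if_pos hpos.le]
      exact h
  have hcoeff (i j) : constantCoeff (φ i j) = 0 := by
    obtain h | ⟨hpos, -⟩ := hφ i j
    · rw [h, map_zero]
    · exact constantCoeff_eq_zero_of_mem_hcomp (hmem i j) hpos.ne'
  obtain ⟨N, hN⟩ := X_pow_mem_maximalMinors hmem hht.ge
  have ex₁ (v) := exists_middleMap_eq hN (v := v)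
  have ex₂ (w) := exists_transpose_mulVec_eq hN (w := w)
  have hd₁ (w) : φ.mulVecLin (middleMap φ w) = 0 := mulVec_middleMap φ w
  have hd₂ (c) : middleMap φ (φ.transpose.mulVecLin c) = 0 := middleMap_transpose_mulVec φ c
  have reg (m : ℕ) := (isRegularTriple_X (K := K)).pi (Fin m)
  refine ⟨fun t ht x hx hsoc => ?_, ?_⟩
  · obtain ⟨u, hu, rfl⟩ := hx
    obtain ⟨v, w, c, h⟩ := exists_isZigzag_of_socle ex₁ ex₂ fun k =>
      (Submodule.Quotient.mk_eq_zero _).1 (hsoc k)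
    obtain ⟨v, w, h⟩ := h.gradedProj_buchsbaumRim hmem hd t
    rw [gradedProj_eq_self fun i => hu i (Set.mem_univ i)] at h
    obtain ⟨e, he⟩ := exists_eq_X_smul_of_constantCoeff_eq_zero
      (c := gradedProj (fun i => d - a i) (t + 3) c) fun i => by
        have := ha (show ⟨0, hn⟩ ≤ i from Nat.zero_le _)
        exact constantCoeff_eq_zero_of_mem_hcomp (hproj_mem _ _) (by lia)
    exact (Submodule.Quotient.mk_eq_zero _).2 (h.exists_d₁_eq (reg _) (reg _) (reg _) hd₁ hd₂ e he)
  · let c : Fin n → MvPolynomial (Fin 3) K := Pi.single ⟨0, hn⟩ 1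
    obtain ⟨e, he⟩ := exists_eq_X_smul_of_constantCoeff_eq_zero
      (c := φ.transpose.mulVecLin c) fun j => by
        rw [Matrix.mulVecLin_apply, Matrix.mulVec_single_one]
        exact hcoeff _ j
    obtain ⟨u, v, h⟩ := exists_isZigzag_of_d₃_eq (f := X) (d₁ := φ.mulVecLin) (d₂ := middleMap φ)
      (w := ![e 0, -e 1, e 2]) (reg n) (reg (n + 2)) hd₁ hd₂ (he.trans (by simp))
    obtain ⟨v, w, h⟩ := h.gradedProj_buchsbaumRim hmem hd (d - a ⟨0, hn⟩ - 3)
    rw [gradedProj_eq_self (u := c) fun i => by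
      convert single_mem_hcomp a ⟨0, hn⟩ i using 2
      ring] at h
    refine ⟨_, ⟨_, fun i _ => hproj_mem _ (u i), rfl⟩, fun k => ?_, fun hx => ?_⟩
    · exact (Submodule.Quotient.mk_eq_zero _).2 ⟨_, h.d₁_eq k⟩
    · obtain ⟨q, hq⟩ := (Submodule.Quotient.mk_eq_zero _).1 hx
      obtain ⟨e, he⟩ := h.exists_eq_of_d₁_eq ex₁ ex₂
        (transpose_mulVec_injective_of_X_pow_mem hN) hq
      have := congrArg constantCoeff (congrFun he ⟨0, hn⟩)
      simp [c] at this
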